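/- Assume c ≥ 48, center separation, centers ν_1,…,ν_k ∈ ℝ^d with ‖μ_r − ν_r‖ ≤ 6·Δ_r for every r, and let Â be an n×d real matrix with ‖Â − C‖_F² ≤ 8·n_r·Δ_r² for every r. Let z : {1,…,n} → {1,…,k} be any assignment with ‖Â_i − ν_{z(i)}‖ ≤ ‖Â_i − ν_s‖ for all i and all s. Let n_{r₂} denote the second-largest value among the cluster sizes n_1,…,n_k (counted with multiplicity). Then the total number of indices i for which z(i) differs from the index of the target cluster containing i is at most (128/c²)·n_{r₂}. -/

import Mathlib

open Finset
open scoped Classical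

noncomputable section

/-- Spectral (ℓ₂ operator) norm of a real matrix. -/
def specNorm {m p : Type*} [Fintype m] [Fintype p] [DecidableEq p] (M : Matrix m p ℝ) : ℝ :=
  ‖LinearMap.toContinuousLinearMap (Matrix.toEuclideanLin M)‖

/-- Frobenius norm of a real matrix. -/
def frobNorm {m p : Type*} [Fintype m] [Fintype p] (M : Matrix m p ℝ) : ℝ :=
  Real.sqrt (∑ i, ∑ j, (M i j) ^ 2)

variable {n d k : ℕ}

/-- The i-th row of a matrix, viewed as a point of Euclidean space. -/
def row (M : Matrix (Fin n) (Fin d) ℝ) (i : Fin n) : EuclideanSpace ℝ (Fin d) :=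
  (WithLp.equiv 2 (Fin d → ℝ)).symm (M i)

/-- The set of indices assigned to cluster `r` by the clustering `τ`. -/
def cluster (τ : Fin n → Fin k) (r : Fin k) : Finset (Fin n) :=
  Finset.univ.filter fun i => τ i = r

/-- The size `n_r` of cluster `r`. -/
def clusterSize (τ : Fin n → Fin k) (r : Fin k) : ℕ := (cluster τ r).card

/-- The mean of the rows of `M` indexed by `S`. -/
def meanOf (M : Matrix (Fin n) (Fin d) ℝ) (S : Finset (Fin n)) : EuclideanSpace ℝ (Fin d) :=
  (S.card : ℝ)⁻¹ • ∑ i ∈ S, row M i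

/-- The mean `μ_r` of cluster `r`. -/
def mu (A : Matrix (Fin n) (Fin d) ℝ) (τ : Fin n → Fin k) (r : Fin k) :
    EuclideanSpace ℝ (Fin d) :=
  meanOf A (cluster τ r)

/-- The matrix `C` whose i-th row is the mean of the cluster containing `i`. -/
def centerMatrix (A : Matrix (Fin n) (Fin d) ℝ) (τ : Fin n → Fin k) :
    Matrix (Fin n) (Fin d) ℝ :=
  fun i j => mu A τ (τ i) j

/-- `Δ_r = (1/√n_r) · min {√k·‖A−C‖, ‖A−C‖_F}`. -/
def Delta (A : Matrix (Fin n) (Fin d) ℝ) (τ : Fin n → Fin k) (r : Fin k) : ℝ :=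
  (Real.sqrt (clusterSize τ r))⁻¹ *
    min (Real.sqrt k * specNorm (A - centerMatrix A τ)) (frobNorm (A - centerMatrix A τ))

end

lemma specNorm_pos {m p : Type*} [Fintype m] [Fintype p] [DecidableEq p] {M : Matrix m p ℝ}
    (hM : M ≠ 0) : 0 < specNorm M := by
  unfold specNorm
  rw [norm_pos_iff]
  simpa using hM

lemma frobNorm_sq {m p : Type*} [Fintype m] [Fintype p] (M : Matrix m p ℝ) :
    frobNorm M ^ 2 = ∑ i, ∑ j, (M i j) ^ 2 :=
  Real.sq_sqrt (Finset.sum_nonneg fun _ _ => Finset.sum_nonneg fun _ _ => sq_nonneg _)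

lemma frobNorm_pos {m p : Type*} [Fintype m] [Fintype p] {M : Matrix m p ℝ} (hM : M ≠ 0) :
    0 < frobNorm M := by
  refine Real.sqrt_pos.2 ?_
  obtain ⟨i, j, hij⟩ : ∃ i j, M i j ≠ 0 := by
    by_contra! h
    exact hM (Matrix.ext h)
  refine Finset.sum_pos' (fun _ _ => Finset.sum_nonneg fun _ _ => sq_nonneg _)
    ⟨i, Finset.mem_univ i, ?_⟩
  exact Finset.sum_pos' (fun _ _ => sq_nonneg _) ⟨j, Finset.mem_univ j, by positivity⟩

lemma frobNorm_sub_centerMatrix_sq {n d k : ℕ} (A B : Matrix (Fin n) (Fin d) ℝ)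
    (τ : Fin n → Fin k) :
    frobNorm (B - centerMatrix A τ) ^ 2 = ∑ i, ‖row B i - mu A τ (τ i)‖ ^ 2 := by
  rw [frobNorm_sq]
  refine Finset.sum_congr rfl fun i _ => ?_
  rw [EuclideanSpace.real_norm_sq_eq]
  rfl

lemma Delta_pos {n d k : ℕ} {A : Matrix (Fin n) (Fin d) ℝ} {τ : Fin n → Fin k} (hk : 0 < k)
    (hAC : A ≠ centerMatrix A τ) {r : Fin k} (hr : (cluster τ r).Nonempty) :
    0 < Delta A τ r := by
  have hn : 0 < (clusterSize τ r : ℝ) := Nat.cast_pos.2 hr.card_pos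
  have hk' : 0 < (k : ℝ) := Nat.cast_pos.2 hk
  have h := sub_ne_zero.2 hAC
  have hs := specNorm_pos h
  have hf := frobNorm_pos h
  unfold Delta
  positivity

lemma clusterSize_mul_Delta_sq {n d k : ℕ} (A : Matrix (Fin n) (Fin d) ℝ) {τ : Fin n → Fin k}
    {r : Fin k} (hr : (cluster τ r).Nonempty) :
    clusterSize τ r * Delta A τ r ^ 2 =
      min (Real.sqrt k * specNorm (A - centerMatrix A τ))
        (frobNorm (A - centerMatrix A τ)) ^ 2 := by
  have hn : 0 < (clusterSize τ r : ℝ) := Nat.cast_pos.2 hr.card_pos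
  rw [Delta, mul_pow, inv_pow, Real.sq_sqrt hn.le, mul_inv_cancel_left₀ (ne_of_gt hn)]

/-- A point that is at least as close to a perturbation of `q` as to a perturbation of `p`
is far from `p`. -/
lemma le_norm_sub_of_nearest {E : Type*} [SeminormedAddCommGroup E] {x p q p' q' : E}
    {a b c : ℝ} (hc : 48 ≤ c) (ha : 0 ≤ a) (hb : 0 ≤ b) (hsep : c * (a + b) ≤ ‖p - q‖)
    (hp : ‖p - p'‖ ≤ 6 * a) (hq : ‖q - q'‖ ≤ 6 * b) (hx : ‖x - q'‖ ≤ ‖x - p'‖) :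
    c / 4 * (a + b) ≤ ‖x - p‖ := by
  have h₁ : ‖p - q‖ ≤ ‖x - p‖ + ‖x - q‖ := by
    simpa [norm_sub_rev] using norm_sub_le_norm_sub_add_norm_sub p x q
  have h₂ : ‖x - q‖ ≤ ‖x - q'‖ + ‖q - q'‖ := by
    simpa [norm_sub_rev] using norm_sub_le_norm_sub_add_norm_sub x q' q
  have h₃ := norm_sub_le_norm_sub_add_norm_sub x p p'
  nlinarith [mul_nonneg (sub_nonneg.2 hc) (add_nonneg ha hb)]

/-- under center separation (with `c ≥ 48`), matched centers `ν_r` and a nearest-center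
assignment `z` on the rows of `Â`, the total number of misclassified points is at most
`(128/c²)·n_{r₂}`, where `n_{r₂} = max_{r ≠ s} min{n_r, n_s}` is the second-largest cluster size
counted with multiplicity. -/
theorem stmt6 {n d k : ℕ} (hk : 2 ≤ k) (A Ahat : Matrix (Fin n) (Fin d) ℝ)
    (τ : Fin n → Fin k) (hfib : ∀ r, (cluster τ r).Nonempty)
    (c : ℝ) (hc : 48 ≤ c)
    (hAC : A ≠ centerMatrix A τ)
    (hsep : ∀ r s, r ≠ s → c * (Delta A τ r + Delta A τ s) ≤ ‖mu A τ r - mu A τ s‖)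
    (ν : Fin k → EuclideanSpace ℝ (Fin d))
    (hν : ∀ r, ‖mu A τ r - ν r‖ ≤ 6 * Delta A τ r)
    (hAhat : ∀ r, frobNorm (Ahat - centerMatrix A τ) ^ 2 ≤
      8 * clusterSize τ r * Delta A τ r ^ 2)
    (z : Fin n → Fin k) (hz : ∀ i s, ‖row Ahat i - ν (z i)‖ ≤ ‖row Ahat i - ν s‖) :
    ((Finset.univ.filter fun i => z i ≠ τ i).card : ℝ) ≤
      128 / c ^ 2 *
        ((Finset.univ.sup fun p : Fin k × Fin k =>
          if p.1 = p.2 then 0 else min (clusterSize τ p.1) (clusterSize τ p.2)) : ℕ) := by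
  have hD : ∀ r, 0 < Delta A τ r := fun r => Delta_pos (by lia) hAC (hfib r)
  have hmul := fun r => clusterSize_mul_Delta_sq A (hfib r)
  set e := min (Real.sqrt k * specNorm (A - centerMatrix A τ))
    (frobNorm (A - centerMatrix A τ))
  have hepos : 0 < e ^ 2 := by
    let r₀ : Fin k := ⟨0, by lia⟩
    have hn : 0 < (clusterSize τ r₀ : ℝ) := Nat.cast_pos.2 (hfib r₀).card_pos
    have hpos := hD r₀
    rw [← hmul r₀]
    positivity
  have hF : ∑ i, ‖row Ahat i - mu A τ (τ i)‖ ^ 2 ≤ 8 * e ^ 2 := by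
    rw [← frobNorm_sub_centerMatrix_sq, ← hmul ⟨0, by lia⟩, ← mul_assoc]
    exact hAhat _
  set m : ℕ := Finset.univ.sup fun p : Fin k × Fin k =>
    if p.1 = p.2 then 0 else min (clusterSize τ p.1) (clusterSize τ p.2)
  have hmis : ∀ i, z i ≠ τ i →
      c ^ 2 / 16 * e ^ 2 ≤ m * ‖row Ahat i - mu A τ (τ i)‖ ^ 2 := by
    intro i hi
    have hdist := le_norm_sub_of_nearest hc (hD (τ i)).le (hD (z i)).le
      (hsep _ _ hi.symm) (hν _) (hν _) (hz i (τ i))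
    have hmin : min (clusterSize τ (z i)) (clusterSize τ (τ i)) ≤ m := by
      have h := Finset.le_sup (f := fun p : Fin k × Fin k =>
        if p.1 = p.2 then 0 else min (clusterSize τ p.1) (clusterSize τ p.2))
        (Finset.mem_univ (z i, τ i))
      simpa only [if_neg hi] using h
    have hsize : ∃ r, clusterSize τ r ≤ m ∧ Delta A τ r ≤ Delta A τ (τ i) + Delta A τ (z i) := by
      rcases min_le_iff.1 hmin with h | h
      · exact ⟨_, h, by linarith [hD (τ i)]⟩
      · exact ⟨_, h, by linarith [hD (z i)]⟩
    obtain ⟨r, hrm, hr⟩ := hsize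
    have hpos := hD r
    calc c ^ 2 / 16 * e ^ 2 = clusterSize τ r * (c / 4 * Delta A τ r) ^ 2 := by
          rw [← hmul r]; ring
      _ ≤ m * ‖row Ahat i - mu A τ (τ i)‖ ^ 2 := by
          gcongr
          exact (mul_le_mul_of_nonneg_left hr (by positivity)).trans hdist
  have hsum : ((Finset.univ.filter fun i => z i ≠ τ i).card : ℝ) * (c ^ 2 / 16 * e ^ 2) ≤
      m * (8 * e ^ 2) :=
    calc _ = ∑ i ∈ Finset.univ.filter fun i => z i ≠ τ i, c ^ 2 / 16 * e ^ 2 := by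
          rw [Finset.sum_const, nsmul_eq_mul]
      _ ≤ ∑ i ∈ Finset.univ.filter fun i => z i ≠ τ i,
            m * ‖row Ahat i - mu A τ (τ i)‖ ^ 2 :=
          Finset.sum_le_sum fun i hi => hmis i (Finset.mem_filter.1 hi).2
      _ ≤ ∑ i, m * ‖row Ahat i - mu A τ (τ i)‖ ^ 2 :=
          Finset.sum_le_sum_of_subset_of_nonneg (Finset.filter_subset _ _)
            fun _ _ _ => by positivity
      _ ≤ m * (8 * e ^ 2) := by
          rw [← Finset.mul_sum]
          gcongr
  rw [div_mul_eq_mul_div, le_div_iff₀ (by positivity)]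
  refine le_of_mul_le_mul_right ?_ hepos
  linarith
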